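/- arXiv:1311.3623 — 7 statements merged into one kernel-verified Lean document; each statement's English description precedes it below -/
import Mathlib

section
/- For every node u of T, 3·s_u ≤ b(u). Consequently, every residual budget b(v) is nonnegative and every edge length d(u,v) is nonnegative. -/
namespace StocOrient

/-- State along a root-to-node walk in the tree `T`:
current node's size `sz`, residual budget `bu`, distance traveled `dist`
(i.e. `A_d`), and size instantiated `inst` (i.e. `A_s`). -/
structure St where
  sz : ℚ
  bu : ℚ
  dist : ℚ
  inst : ℚ

/-- One step from a node at level `lvl` to one of its children
(`true` = right child, `false` = left child); the child is at level `lvl - 1`. -/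
def step (lvl : ℕ) (x : St) (dir : Bool) : St :=
  if dir then
    { sz := x.sz * (2 : ℚ) ^ ((2 : ℤ) ^ (lvl - 1)),
      bu := x.bu - x.sz,
      dist := x.dist,
      inst := x.inst + x.sz }
  else
    { sz := x.sz * (2 : ℚ) ^ (-((2 : ℤ) ^ (lvl - 1))),
      bu := x.sz,
      dist := x.dist + (x.bu - x.sz),
      inst := x.inst }

def walkAux : ℕ → St → List Bool → St
  | _, x, [] => x
  | lvl, x, d :: rest => walkAux (lvl - 1) (step lvl x d) rest

/-- The budget `B = 2^(2^(L+1))`. -/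
def Bq (L : ℕ) : ℚ := 2 ^ 2 ^ (L + 1)

/-- Data at the root: `s_ρ = 2^(2^L)`, `b(ρ) = B`, `A_d(ρ) = A_s(ρ) = 0`. -/
def start (L : ℕ) : St := ⟨2 ^ 2 ^ L, Bq L, 0, 0⟩

/-- A node of the tree `T` is identified with its root-to-node path
(`true` = right branch); nodes of `T` are exactly the paths of length `< L`. -/
def walk (L : ℕ) (v : List Bool) : St := walkAux L (start L) v

/-- The size `s_v`. -/
def size (L : ℕ) (v : List Bool) : ℚ := (walk L v).sz

/-- The residual budget `b(v)`. -/
def budget (L : ℕ) (v : List Bool) : ℚ := (walk L v).bu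

/-- `A_d(v)`: total edge length on the root-to-`v` path. -/
def Ad (L : ℕ) (v : List Bool) : ℚ := (walk L v).dist

/-- `A_s(v)`: total size of strict ancestors of `v` from which the path to `v`
goes right. -/
def As (L : ℕ) (v : List Bool) : ℚ := (walk L v).inst

/-- The level `ℓ(v)`: the root is at level `L`, the leaves at level `1`. -/
def level (L : ℕ) (v : List Bool) : ℕ := L - v.length

end StocOrient

open StocOrient

/-- A state whose budget is at least `2 ^ 2 ^ l - 1` times its positive size yields, after one
step, a state with the same property one level below. -/
lemma StocOrient.step_invariant (l : ℕ) (x : St) (d : Bool) (hs : 0 < x.sz)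
    (hb : x.sz * (2 ^ 2 ^ (l + 1) - 1) ≤ x.bu) :
    0 < (step (l + 1) x d).sz ∧
      (step (l + 1) x d).sz * (2 ^ 2 ^ l - 1) ≤ (step (l + 1) x d).bu := by
  have hz : (2 : ℚ) ^ ((2 : ℤ) ^ l) = 2 ^ 2 ^ l := by
    rw [← zpow_natCast]
    push_cast
    rfl
  have hX : (2 : ℚ) ≤ 2 ^ 2 ^ l := le_self_pow₀ (by norm_num) (by positivity)
  rw [pow_succ, pow_mul] at hb
  cases d
  · simp only [step, Bool.false_eq_true, if_false, Nat.add_sub_cancel, zpow_neg, hz]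
    refine ⟨by positivity, ?_⟩
    rw [mul_assoc]
    refine mul_le_of_le_one_right hs.le ?_
    rw [inv_mul_le_iff₀ (by positivity)]
    linarith
  · simp only [step, if_true, Nat.add_sub_cancel, hz]
    refine ⟨by positivity, ?_⟩
    nlinarith

lemma StocOrient.three_mul_sz_le_bu_walkAux (v : List Bool) (l : ℕ) (x : St)
    (hs : 0 < x.sz) (hb : x.sz * (2 ^ 2 ^ l - 1) ≤ x.bu) (hv : v.length < l) :
    0 < (walkAux l x v).sz ∧ 3 * (walkAux l x v).sz ≤ (walkAux l x v).bu := by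
  induction v generalizing l x with
  | nil =>
    refine ⟨hs, ?_⟩
    have hl : 2 ≤ 2 ^ l := le_self_pow₀ (by norm_num) (by simp at hv; omega)
    have h4 : (2 : ℚ) ^ 2 ≤ 2 ^ 2 ^ l := pow_le_pow_right₀ (by norm_num) hl
    simp only [walkAux]
    nlinarith
  | cons d v ih =>
    obtain ⟨l, rfl⟩ : ∃ k, l = k + 1 := ⟨l - 1, by omega⟩
    obtain ⟨hs', hb'⟩ := step_invariant l x d hs hb
    exact ih l _ hs' hb' (by simpa using hv)

lemma StocOrient.size_pos_and_three_mul_size_le_budget (L : ℕ) (v : List Bool)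
    (hv : v.length < L) : 0 < size L v ∧ 3 * size L v ≤ budget L v := by
  refine three_mul_sz_le_bu_walkAux v L (start L) (by simp [start]) ?_ hv
  simp only [start, Bq, pow_succ, pow_mul]
  have : (0 : ℚ) < 2 ^ 2 ^ L := by positivity
  nlinarith

/-- For every node `u` of `T`, `3·s_u ≤ b(u)`; consequently all residual
budgets are nonnegative and all edge lengths (the right edge has length 0, the
left edge out of `u` has length `b(u) - s_u`) are nonnegative. -/
theorem stmt2 (L : ℕ) (hL : 2 ≤ L) :
    (∀ u : List Bool, u.length < L → 3 * size L u ≤ budget L u) ∧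
    (∀ v : List Bool, v.length < L → 0 ≤ budget L v) ∧
    (∀ u : List Bool, u.length + 1 < L → 0 ≤ budget L u - size L u) := by
  have h := size_pos_and_three_mul_size_le_budget L
  refine ⟨fun u hu => (h u hu).2, fun v hv => ?_, fun u hu => ?_⟩
  · linarith [(h v hv).1, (h v hv).2]
  · have hu' : u.length < L := by omega
    linarith [(h u hu').1, (h u hu').2]
end

section
/- For every node v of T, the total size instantiation observed by the adaptive policy before v is strictly smaller than the size of v; that is, A_s(v) < s_v. -/
namespace StocOrient

lemma inst_lt_sz {l : ℕ} {x : St} (hl : 1 ≤ l) (hi : 0 ≤ x.inst)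
    (h : x.inst * 2 ^ 2 ^ l < 4 * x.sz) : x.inst < x.sz := by
  have h4 : (4 : ℚ) ≤ 2 ^ 2 ^ l := by
    calc (4 : ℚ) = 2 ^ 2 ^ 1 := by norm_num
      _ ≤ 2 ^ 2 ^ l := by gcongr <;> norm_num
  nlinarith [mul_le_mul_of_nonneg_left h4 hi]

/-- The bound `A_s * 2 ^ 2 ^ ℓ < 4 * s` at level `ℓ` is preserved by every step of the walk. -/
lemma walkAux_inst_lt_sz (v : List Bool) : ∀ (l : ℕ) (x : St), v.length < l → 0 ≤ x.inst →
    0 < x.sz → x.inst * 2 ^ 2 ^ l < 4 * x.sz → (walkAux l x v).inst < (walkAux l x v).sz := by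
  induction v with
  | nil => exact fun l x hl hi _ h => inst_lt_sz hl hi h
  | cons d v ih =>
    intro l x hl hi hs h
    have hlt := inst_lt_sz (by omega) hi h
    obtain ⟨k, rfl⟩ : ∃ k, l = k + 1 := ⟨l - 1, by grind⟩
    have hc : (0 : ℚ) < 2 ^ 2 ^ k := by positivity
    have hz : (2 : ℚ) ^ ((2 : ℤ) ^ k) = 2 ^ 2 ^ k := by
      rw [← zpow_natCast]
      push_cast
      rfl
    rw [pow_succ 2 k, pow_mul] at h
    rw [walkAux]
    refine ih k _ (by simpa using hl) ?_ ?_ ?_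
    · cases d <;> simp [step] <;> linarith
    · cases d <;> simp only [step] <;> simp <;> positivity
    · cases d
      · simp only [step, Nat.add_sub_cancel, zpow_neg, hz, Bool.false_eq_true, if_false]
        rw [← mul_assoc, ← div_eq_mul_inv, lt_div_iff₀ hc]
        linarith
      · simp only [step, Nat.add_sub_cancel, hz, if_true]
        nlinarith

end StocOrient

open StocOrient

/-- For every node `v` of `T`, the total size instantiation observed by the
adaptive policy before `v` is strictly smaller than `s_v`: `A_s(v) < s_v`. -/
theorem stmt4 (L : ℕ) (hL : 2 ≤ L) (v : List Bool) (hv : v.length < L) :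
    As L v < size L v := by
  refine walkAux_inst_lt_sz v L (start L) hv le_rfl ?_ ?_ <;> simp [start]
end

section
/- For every node v of T, A_d(v) + A_s(v) + s_v ≤ B. In particular, the adaptive policy that at each node goes to the right child upon a positive size instantiation and to the left child otherwise never exhausts the budget B, regardless of the size instantiations, and completes every job it attempts. -/
open StocOrient

/-- Along a walk, distance, instantiated size and residual budget have a constant sum. -/
theorem walkAux_add_bu (n : ℕ) (x : St) (v : List Bool) :
    (walkAux n x v).dist + (walkAux n x v).inst + (walkAux n x v).bu
      = x.dist + x.inst + x.bu := by
  induction v generalizing n x with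
  | nil => rfl
  | cons d v ih =>
    rw [walkAux, ih]
    cases d <;> simp only [step, Bool.false_eq_true, if_true, if_false] <;> ring

/-- The residual budget at level `n` is at least `2 ^ 2 ^ n - 1` times the (positive) size. -/
def BudgetBound (n : ℕ) (x : St) : Prop :=
  0 < x.sz ∧ x.sz * (2 ^ 2 ^ n - 1) ≤ x.bu

theorem two_zpow_two_pow (n : ℕ) : (2 : ℚ) ^ ((2 : ℤ) ^ n) = 2 ^ 2 ^ n := by
  rw [← zpow_natCast]
  norm_cast

theorem two_le_two_pow_two_pow (n : ℕ) : (2 : ℚ) ≤ 2 ^ 2 ^ n :=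
  le_self_pow₀ one_le_two (by positivity)

theorem BudgetBound.step {n : ℕ} {x : St} (h : BudgetBound (n + 1) x) (d : Bool) :
    BudgetBound n (step (n + 1) x d) := by
  obtain ⟨hs, hb⟩ := h
  have hX := two_le_two_pow_two_pow n
  rw [pow_succ 2 n, pow_mul] at hb
  cases d
  · simp only [BudgetBound, StocOrient.step, Bool.false_eq_true, if_false,
      Nat.add_sub_cancel, zpow_neg, two_zpow_two_pow]
    refine ⟨by positivity, ?_⟩
    have hX' : ((2 : ℚ) ^ 2 ^ n)⁻¹ * (2 ^ 2 ^ n - 1) ≤ 1 := by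
      rw [inv_mul_le_iff₀ (by positivity)]
      linarith
    rw [mul_assoc]
    exact mul_le_of_le_one_right hs.le hX'
  · simp only [BudgetBound, StocOrient.step, if_true, Nat.add_sub_cancel, two_zpow_two_pow]
    refine ⟨by positivity, ?_⟩
    nlinarith

theorem BudgetBound.sz_le_bu {n : ℕ} {x : St} (h : BudgetBound n x) : x.sz ≤ x.bu := by
  have hX := two_le_two_pow_two_pow n
  exact (le_mul_of_one_le_right h.1.le (by linarith)).trans h.2

theorem BudgetBound.walkAux {n : ℕ} {x : St} (h : BudgetBound n x) {v : List Bool}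
    (hv : v.length ≤ n) : BudgetBound (n - v.length) (walkAux n x v) := by
  induction v generalizing n x with
  | nil => exact h
  | cons d v ih =>
    obtain _ | n := n
    · simp at hv
    · rw [List.length_cons, Nat.add_sub_add_right]
      exact ih (h.step d) (by simpa using hv)

theorem budgetBound_start (L : ℕ) : BudgetBound L (start L) := by
  have hX := two_le_two_pow_two_pow L
  refine ⟨by simp [start], ?_⟩
  simp only [start, Bq]
  rw [pow_succ 2 L, pow_mul]
  nlinarith

/-- For every node `v` of `T`, `A_d(v) + A_s(v) + s_v ≤ B`: the adaptive
policy never exhausts the budget and completes every job it attempts. -/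
theorem stmt5 (L : ℕ) (hL : 2 ≤ L) (v : List Bool) (hv : v.length < L) :
    Ad L v + As L v + size L v ≤ Bq L := by
  have hsum := walkAux_add_bu L (start L) v
  have hle := ((budgetBound_start L).walkAux hv.le).sz_le_bu
  have hroot : (start L).dist + (start L).inst + (start L).bu = Bq L := by simp [start]
  unfold Ad As size walk
  linarith
end

section
/- Let L ≥ 2 be an integer, p = 1/√L, and let X_1, …, X_L be independent Bernoulli random variables, each equal to 1 with probability p and 0 with probability 1−p. Then the expected reward of the adaptive policy, E[ ∑_{t=1}^{L} (1−p)^{X_1 + ⋯ + X_{t−1}} ], is at least (1 − 1/e)·L. (In particular, the expected reward of the adaptive policy is Ω(L).) -/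
/-- If each of `L` independent coordinates is `true` with weight `p`, then the expectation of
`q ^ k`, where `k` counts the `true` values among the first `t` coordinates, is
`(p * q + (1 - p)) ^ t`. -/
theorem sum_bernoulli_pow_card {R : Type*} [CommRing R] (L t : ℕ) (ht : t ≤ L) (p q : R) :
    ∑ ω : Fin L → Bool,
      (∏ i : Fin L, (if ω i then p else 1 - p)) *
        q ^ (Finset.univ.filter (fun i : Fin L => (i : ℕ) < t ∧ ω i = true)).card =
      (p * q + (1 - p)) ^ t := by
  have hterm (ω : Fin L → Bool) :
      (∏ i : Fin L, (if ω i then p else 1 - p)) *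
        q ^ (Finset.univ.filter (fun i : Fin L => (i : ℕ) < t ∧ ω i = true)).card =
      ∏ i : Fin L, ((if ω i then p else 1 - p) * if (i : ℕ) < t ∧ ω i = true then q else 1) := by
    rw [Finset.prod_mul_distrib, ← Finset.prod_filter, Finset.prod_const]
  have hsum (i : Fin L) :
      ∑ b : Bool, ((if b then p else 1 - p) * if (i : ℕ) < t ∧ b = true then q else 1) =
        if (i : ℕ) < t then p * q + (1 - p) else 1 := by
    by_cases hi : (i : ℕ) < t <;> simp [hi]
  simp_rw [hterm]
  rw [← Fintype.prod_sum
    (fun (i : Fin L) (b : Bool) =>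
      (if b then p else 1 - p) * if (i : ℕ) < t ∧ b = true then q else 1)]
  simp_rw [hsum]
  rw [← Finset.prod_filter, Finset.prod_const, Fin.card_filter_val_lt, min_eq_right ht]

/-- The geometric sum of ratio `1 - 1 / L` over `L` terms is at least `(1 - 1 / e) * L`. -/
theorem le_geom_sum_one_sub_inv (L : ℕ) (hL : 1 ≤ L) :
    (1 - 1 / Real.exp 1) * L ≤ ∑ t ∈ Finset.range L, (1 - 1 / (L : ℝ)) ^ t := by
  have hL0 : (0 : ℝ) < L := by exact_mod_cast hL
  have hgeom := mul_neg_geom_sum (1 - 1 / (L : ℝ)) L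
  have hpow : (1 - 1 / (L : ℝ)) ^ L ≤ 1 / Real.exp 1 := by
    rw [one_div (Real.exp 1), ← Real.exp_neg]
    exact Real.one_sub_div_pow_le_exp_neg (by exact_mod_cast hL)
  have hsum : ∑ t ∈ Finset.range L, (1 - 1 / (L : ℝ)) ^ t = (1 - (1 - 1 / (L : ℝ)) ^ L) * L := by
    rw [← hgeom]
    field_simp
    ring
  rw [hsum]
  gcongr


/-- With `p = 1/√L` and independent Bernoulli(`p`) variables `X_1, …, X_L`
(modeled by the product Bernoulli measure on `Fin L → Bool`), the expected
reward of the adaptive policy, `E[∑_{t=1}^{L} (1-p)^(X_1 + ⋯ + X_{t-1})]`, is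
at least `(1 - 1/e)·L`. -/
theorem stmt6 (L : ℕ) (hL : 2 ≤ L) (p : ℝ) (hp : p = 1 / Real.sqrt L) :
    (1 - 1 / Real.exp 1) * L ≤
      ∑ ω : Fin L → Bool,
        (∏ i : Fin L, (if ω i then p else 1 - p)) *
          ∑ t ∈ Finset.range L,
            (1 - p) ^
              (Finset.univ.filter (fun i : Fin L => (i : ℕ) < t ∧ ω i = true)).card := by
  have hp2 : p * (1 - p) + (1 - p) = 1 - 1 / (L : ℝ) := by
    have hsq : p ^ 2 = 1 / (L : ℝ) := by
      rw [hp, div_pow, one_pow, Real.sq_sqrt (Nat.cast_nonneg L)]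
    rw [← hsq]
    ring
  simp_rw [Finset.mul_sum]
  rw [Finset.sum_comm, Finset.sum_congr rfl fun t ht =>
    sum_bernoulli_pow_card L t (Finset.mem_range.1 ht).le p (1 - p), hp2]
  exact le_geom_sum_one_sub_inv L (by omega)
end

section
/- Let u be an internal node of T with left child u′, and let v be any node that equals u′ or is a descendant of u′. Then A_d(v) + s_u + s_v > B. (Interpretation: if a non-adaptive policy following a root-to-leaf path through u and v observes positive size instantiations at both L-branching nodes u and v, then its total travel distance plus instantiated size exceeds the budget B, so it cannot collect any further reward.) -/
open StocOrient

namespace StocOrient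

/-- Invariant of the walk at a node of level `k`: the instantiated size is smaller than the size of
every descendant, and the residual budget dominates the size of every descendant. -/
structure Invariant (B : ℚ) (k : ℕ) (x : St) : Prop where
  sz_pos : 0 < x.sz
  inst_nonneg : 0 ≤ x.inst
  inst_lt : x.inst * 2 ^ 2 ^ k < 4 * x.sz
  le_bu : x.sz * 2 ^ 2 ^ k ≤ x.bu + x.sz
  total : x.dist + x.inst + x.bu = B

theorem four_le_two_pow_two_pow {k : ℕ} (hk : 1 ≤ k) : (4 : ℚ) ≤ 2 ^ 2 ^ k := by
  have h : 2 ^ 1 ≤ 2 ^ k := Nat.pow_le_pow_right (by norm_num) hk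
  calc (4 : ℚ) = 2 ^ 2 ^ 1 := by norm_num
    _ ≤ 2 ^ 2 ^ k := pow_le_pow_right₀ (by norm_num) h

theorem two_zpow_two_pow (k : ℕ) : (2 : ℚ) ^ ((2 : ℤ) ^ k) = 2 ^ 2 ^ k := by
  exact_mod_cast zpow_natCast (2 : ℚ) (2 ^ k)

theorem Invariant.inst_lt_sz {B : ℚ} {k : ℕ} {x : St} (h : Invariant B k x) (hk : 1 ≤ k) :
    x.inst < x.sz := by
  have := mul_le_mul_of_nonneg_left (four_le_two_pow_two_pow hk) h.inst_nonneg
  linarith [h.inst_lt]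

theorem Invariant.sz_le_bu {B : ℚ} {k : ℕ} {x : St} (h : Invariant B k x) (hk : 1 ≤ k) :
    x.sz ≤ x.bu := by
  have := mul_le_mul_of_nonneg_left (four_le_two_pow_two_pow hk) h.sz_pos.le
  linarith [h.le_bu, h.sz_pos]

theorem Invariant.step {B : ℚ} {k : ℕ} {x : St} (h : Invariant B (k + 1) x) (hk : 1 ≤ k)
    (dir : Bool) : Invariant B k (step (k + 1) x dir) := by
  have ht := four_le_two_pow_two_pow hk
  have hlt := h.inst_lt_sz (Nat.le_add_left 1 k)
  obtain ⟨hs, hi, hil, hb, htot⟩ := h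
  have hsq : (2 : ℚ) ^ 2 ^ (k + 1) = 2 ^ 2 ^ k * 2 ^ 2 ^ k := by
    rw [← pow_add, pow_succ, mul_two]
  rw [hsq] at hil hb
  cases dir
  · simp only [StocOrient.step, Bool.false_eq_true, if_false, Nat.add_sub_cancel, zpow_neg,
      two_zpow_two_pow]
    generalize htk : (2 : ℚ) ^ 2 ^ k = t at *
    have htp : 0 < t := by linarith
    have hdiv : 0 < x.sz * t⁻¹ := by positivity
    refine ⟨hdiv, hi, ?_, ?_, by dsimp only; linarith⟩
    · rw [htk]
      dsimp only
      rw [← mul_assoc, ← div_eq_mul_inv, lt_div_iff₀ htp]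
      linarith
    · rw [htk, inv_mul_cancel_right₀ htp.ne']
      linarith
  · simp only [StocOrient.step, if_true, Nat.add_sub_cancel, two_zpow_two_pow]
    generalize htk : (2 : ℚ) ^ 2 ^ k = t at *
    have htp : 0 < t := by linarith
    refine ⟨by positivity, by dsimp only; linarith, ?_, ?_, by dsimp only; linarith⟩
    · rw [htk, ← mul_assoc]
      have : x.inst + x.sz < 4 * x.sz := by linarith
      exact mul_lt_mul_of_pos_right this htp
    · rw [htk]
      dsimp only
      have := mul_le_mul_of_nonneg_left ht hs.le
      linarith

theorem Invariant.dist_le_step {B : ℚ} {k : ℕ} {x : St} (h : Invariant B k x) (hk : 1 ≤ k)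
    (dir : Bool) : x.dist ≤ (StocOrient.step k x dir).dist := by
  cases dir <;> simp [StocOrient.step, h.sz_le_bu hk]

theorem Invariant.inst_le_step {B : ℚ} {k : ℕ} {x : St} (h : Invariant B k x)
    (dir : Bool) : x.inst ≤ (StocOrient.step k x dir).inst := by
  cases dir <;> simp [StocOrient.step, h.sz_pos.le]

theorem Invariant.walkAux {B : ℚ} (w : List Bool) {k : ℕ} {x : St} (h : Invariant B k x)
    (hw : w.length < k) :
    Invariant B (k - w.length) (walkAux k x w) ∧
      x.dist ≤ (StocOrient.walkAux k x w).dist ∧ x.inst ≤ (StocOrient.walkAux k x w).inst := by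
  induction w generalizing k x with
  | nil => exact ⟨h, le_rfl, le_rfl⟩
  | cons d w ih =>
    obtain _ | k := k
    · simp at hw
    have hw' : w.length < k := by simpa using hw
    obtain ⟨h1, h2, h3⟩ := ih (h.step (by omega) d) hw'
    rw [List.length_cons, Nat.add_sub_add_right]
    exact ⟨h1, (h.dist_le_step (by omega) d).trans h2, (h.inst_le_step d).trans h3⟩

theorem walkAux_append (k : ℕ) (x : St) (u w : List Bool) :
    walkAux k x (u ++ w) = walkAux (k - u.length) (walkAux k x u) w := by
  induction u generalizing k x with
  | nil => rfl
  | cons d u ih =>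
    simp only [List.cons_append, walkAux, ih, List.length_cons]
    rw [Nat.sub_sub, Nat.add_comm 1]

theorem invariant_start (L : ℕ) : Invariant (Bq L) L (start L) := by
  have hs : (0 : ℚ) < 2 ^ 2 ^ L := by positivity
  refine ⟨hs, le_rfl, ?_, ?_, ?_⟩
  · simp [start]
  · simp only [start, Bq]
    rw [← pow_add, ← mul_two, ← pow_succ]
    linarith
  · simp [start]

end StocOrient

/-- If `u` is an internal node with left child `u ++ [false]`, and `v` equals
that left child or is a descendant of it, then `A_d(v) + s_u + s_v > B`. -/
theorem stmt8 (L : ℕ) (hL : 2 ≤ L) (u v : List Bool) (hv : v.length < L)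
    (hpre : (u ++ [false]) <+: v) :
    Bq L < Ad L v + size L u + size L v := by
  obtain ⟨w, rfl⟩ := hpre
  have hlen : u.length + (w.length + 1) < L := by
    simp only [List.length_append, List.length_cons, List.length_nil] at hv
    omega
  obtain ⟨hu, -, -⟩ := (invariant_start L).walkAux u (by omega)
  obtain ⟨m, hm⟩ : ∃ m, L - u.length = m + 1 := ⟨L - u.length - 1, by omega⟩
  rw [List.append_assoc, List.singleton_append]
  simp only [Ad, size, walk, walkAux_append L _ u, hm, walkAux]
  rw [hm] at hu
  obtain ⟨hv, hdist, hinst⟩ := (hu.step (by omega) false).walkAux w (by omega)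
  have hlt := hv.inst_lt_sz (by omega)
  have htot := hu.total
  simp only [step, Bool.false_eq_true, if_false, Nat.add_sub_cancel] at hdist hinst hlt ⊢
  linarith
end

section
/- Every directed non-adaptive policy has expected collected reward at most 3√L. That is, for every root-to-leaf path P of T and every subset S of the nodes of P, the expectation of the total reward collected is at most 3·√L. -/
open StocOrient

namespace StocOrient

lemma walkAux_append_s9 (lvl : ℕ) (x : St) (l : List Bool) (d : Bool) :
    walkAux lvl x (l ++ [d]) = step (lvl - l.length) (walkAux lvl x l) d := by
  induction l generalizing lvl x with
  | nil => simp [walkAux]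
  | cons a l ih =>
    simp only [List.cons_append, walkAux, ih, List.length_cons]
    congr 1
    omega

lemma walk_take_succ (L : ℕ) {P : List Bool} {t : ℕ} {d : Bool} (h : P[t]? = some d) :
    walk L (P.take (t + 1)) = step (L - t) (walk L (P.take t)) d := by
  have ht : t < P.length := (List.getElem?_eq_some_iff.1 h).1
  rw [List.take_add_one, h, Option.toList_some, walk, walkAux_append_s9, List.length_take,
    min_eq_left ht.le, walk]

lemma step_true (lvl : ℕ) (x : St) :
    step lvl x true =
      ⟨x.sz * 2 ^ 2 ^ (lvl - 1), x.bu - x.sz, x.dist, x.inst + x.sz⟩ := by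
  simp only [step, if_true, St.mk.injEq, and_true]
  norm_cast

lemma step_false (lvl : ℕ) (x : St) :
    step lvl x false =
      ⟨x.sz * (2 ^ 2 ^ (lvl - 1))⁻¹, x.sz, x.dist + (x.bu - x.sz), x.inst⟩ := by
  simp only [step, Bool.false_eq_true, if_false, St.mk.injEq, and_true, zpow_neg]
  norm_cast

lemma two_pow_two_pow_pred {h : ℕ} (hh : 1 ≤ h) :
    (2 : ℚ) ^ 2 ^ h = 2 ^ 2 ^ (h - 1) * 2 ^ 2 ^ (h - 1) := by
  obtain ⟨k, rfl⟩ := Nat.exists_eq_add_of_le' hh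
  rw [Nat.add_sub_cancel, ← pow_add, pow_succ, mul_two]

lemma four_le_two_pow_two_pow_s9 {h : ℕ} (hh : 1 ≤ h) : (4 : ℚ) ≤ 2 ^ 2 ^ h := by
  calc (4 : ℚ) = 2 ^ 2 ^ 1 := by norm_num
    _ ≤ 2 ^ 2 ^ h := by gcongr <;> norm_num

/-- Traveled distance, right-ancestor sizes and residual budget always add up to `B`. -/
lemma dist_add_inst_add_bu (L : ℕ) (P : List Bool) (t : ℕ) (ht : t ≤ P.length) :
    (walk L (P.take t)).dist + (walk L (P.take t)).inst + (walk L (P.take t)).bu = Bq L := by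
  induction t with
  | zero => simp [walk, walkAux, start]
  | succ t ih =>
    have ih := ih (by omega)
    have hd : P[t]? = some P[t] := List.getElem?_eq_getElem (by omega)
    rw [walk_take_succ L hd]
    cases P[t]
    · rw [step_false]; linarith
    · rw [step_true]; linarith

lemma sz_pos (L : ℕ) (P : List Bool) (t : ℕ) (ht : t ≤ P.length) :
    0 < (walk L (P.take t)).sz := by
  induction t with
  | zero => simp [walk, walkAux, start]
  | succ t ih =>
    have ih := ih (by omega)
    have hd : P[t]? = some P[t] := List.getElem?_eq_getElem (by omega)
    rw [walk_take_succ L hd]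
    cases P[t]
    · rw [step_false]; positivity
    · rw [step_true]; positivity

lemma size_nonneg (L : ℕ) (P : List Bool) (t : ℕ) : 0 ≤ size L (P.take t) := by
  rcases le_total t P.length with h | h
  · exact (sz_pos L P t h).le
  · have := sz_pos L P P.length le_rfl
    rw [List.take_length] at this
    rw [List.take_of_length_le h]
    exact this.le

/-- The right-ancestor sizes are negligible compared with the current size. -/
lemma inst_mul_le (L : ℕ) (P : List Bool) (t : ℕ) (ht : t ≤ P.length) (hL : P.length < L) :
    0 ≤ (walk L (P.take t)).inst ∧
      (walk L (P.take t)).inst * 2 ^ 2 ^ (L - t) ≤ 2 * (walk L (P.take t)).sz := by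
  induction t with
  | zero => simp [walk, walkAux, start]
  | succ t ih =>
    obtain ⟨h0, h1⟩ := ih (by omega)
    have hd : P[t]? = some P[t] := List.getElem?_eq_getElem (by omega)
    have hs := sz_pos L P t (by omega)
    rw [two_pow_two_pow_pred (by omega : 1 ≤ L - t)] at h1
    have hy := four_le_two_pow_two_pow_s9 (by omega : 1 ≤ L - t - 1)
    rw [walk_take_succ L hd, show L - (t + 1) = L - t - 1 by omega]
    set y : ℚ := 2 ^ 2 ^ (L - t - 1)
    set x := walk L (P.take t)
    have hy0 : 0 < y := by linarith
    cases P[t]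
    · rw [step_false]
      refine ⟨h0, ?_⟩
      change x.inst * y ≤ 2 * (x.sz * y⁻¹)
      rw [← mul_assoc, ← div_eq_mul_inv, le_div_iff₀ hy0]
      linarith
    · rw [step_true]
      refine ⟨by dsimp only; positivity, ?_⟩
      change (x.inst + x.sz) * y ≤ 2 * (x.sz * y)
      have hyy : 2 ≤ y * y := by nlinarith
      have : x.inst ≤ x.sz := by nlinarith [mul_le_mul_of_nonneg_left hyy h0]
      nlinarith [mul_le_mul_of_nonneg_right this hy0.le]

/-- After a left branch at `i`, all sizes stay well below the size at `i`. -/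
lemma sz_mul_le (L : ℕ) (P : List Bool) (i j : ℕ) (hi : P[i]? = some false) (hij : i < j)
    (hj : j ≤ P.length) (hL : P.length < L) :
    (walk L (P.take j)).sz * 2 ^ 2 ^ (L - j) ≤ (walk L (P.take i)).sz := by
  induction j, hij using Nat.le_induction with
  | base =>
    rw [walk_take_succ L hi, step_false, show L - i.succ = L - i - 1 by omega]
    dsimp only
    rw [inv_mul_cancel_right₀ (by positivity)]
  | succ j hij ih =>
    have ih := ih (by omega)
    have hd : P[j]? = some P[j] := List.getElem?_eq_getElem (by omega)
    have hs := sz_pos L P j (by omega)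
    rw [two_pow_two_pow_pred (by omega : 1 ≤ L - j)] at ih
    have hy := four_le_two_pow_two_pow_s9 (by omega : 1 ≤ L - j - 1)
    rw [walk_take_succ L hd, show L - (j + 1) = L - j - 1 by omega]
    set y : ℚ := 2 ^ 2 ^ (L - j - 1)
    set x := walk L (P.take j)
    cases P[j]
    · rw [step_false]
      change x.sz * y⁻¹ * y ≤ _
      rw [inv_mul_cancel_right₀ (by positivity)]
      have hyy : 1 ≤ y * y := by nlinarith
      exact (le_mul_of_one_le_right hs.le hyy).trans ih
    · rw [step_true]
      change x.sz * y * y ≤ _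
      linarith

/-- Once two left branches `i < j` have been taken, a full-size instantiation at `i` exhausts
the budget. -/
lemma lt_Ad_add_size (L : ℕ) (P : List Bool) (i j k : ℕ) (hi : P[i]? = some false) (hij : i < j)
    (hj : P[j]? = some false) (hjk : j < k) (hk : k ≤ P.length) (hL : P.length < L) :
    Bq L < Ad L (P.take k) + size L (P.take i) := by
  have key : ∀ j, i < j → j ≤ P.length →
      (walk L (P.take j)).sz + (walk L (P.take j)).inst < (walk L (P.take i)).sz := by
    intro j hij hj
    have hy := four_le_two_pow_two_pow_s9 (by omega : 1 ≤ L - j)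
    have h1 := sz_mul_le L P i j hi hij hj hL
    obtain ⟨h2, h3⟩ := inst_mul_le L P j hj hL
    have h4 := sz_pos L P j hj
    have h5 := mul_le_mul_of_nonneg_left hy h4.le
    have h6 := mul_le_mul_of_nonneg_left hy h2
    linarith
  have hbu : (walk L (P.take k)).bu + (walk L (P.take k)).inst < (walk L (P.take i)).sz := by
    induction k, hjk using Nat.le_induction with
    | base =>
      rw [walk_take_succ L hj, step_false]
      exact key j hij (by omega)
    | succ k hjk ih =>
      have ih := ih (by omega)
      have hd : P[k]? = some P[k] := List.getElem?_eq_getElem (by omega)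
      rw [walk_take_succ L hd]
      cases P[k]
      · rw [step_false]
        exact key k (by omega) (by omega)
      · rw [step_true]
        dsimp only
        linarith
  have := dist_add_inst_add_bu L P k hk
  rw [Ad, size]
  linarith

end StocOrient

lemma sum_comp_le_of_hasSum {ι : Type*} {N : Finset ι} {g : ι → ℕ} (hg : Set.InjOn g N)
    {f : ℕ → ℝ} (hf : ∀ n, 0 ≤ f n) {c : ℝ} (hc : HasSum f c) : ∑ t ∈ N, f (g t) ≤ c := by
  rw [← Finset.sum_image (f := f) hg]
  exact sum_le_hasSum _ (fun n _ => hf n) hc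

lemma sum_pow_comp_le {ι : Type*} {N : Finset ι} {g : ι → ℕ} (hg : Set.InjOn g N)
    {p : ℝ} (hp : 0 < p) (hp1 : p ≤ 1) : ∑ t ∈ N, (1 - p) ^ g t ≤ 1 / p := by
  have := hasSum_geometric_of_lt_one (sub_nonneg.2 hp1) (sub_lt_self 1 hp)
  rw [sub_sub_cancel, ← one_div] at this
  exact sum_comp_le_of_hasSum hg (fun n => pow_nonneg (sub_nonneg.2 hp1) n) this

lemma sum_pow_comp_pred_le {ι : Type*} {N : Finset ι} {g : ι → ℕ} (hg : Set.InjOn g N)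
    {p : ℝ} (hp : 0 < p) (hp1 : p ≤ 1) : ∑ t ∈ N, (1 - p) ^ (g t - 1) ≤ 1 + 1 / p := by
  have := hasSum_geometric_of_lt_one (sub_nonneg.2 hp1) (sub_lt_self 1 hp)
  rw [sub_sub_cancel, ← one_div] at this
  refine sum_comp_le_of_hasSum (f := fun n => (1 - p) ^ (n - 1)) hg
    (fun n => pow_nonneg (sub_nonneg.2 hp1) _) ?_
  rw [← hasSum_nat_add_iff' 1]
  simpa using this

/-- The probability that no coordinate in `A` succeeds. -/
lemma sum_bernoulli_mul_prod {ι : Type*} [Fintype ι] [DecidableEq ι] (p : ℝ) (A : Finset ι) :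
    ∑ ω : ι → Bool, (∏ i, (if ω i then p else 1 - p)) * ∏ i ∈ A, (if ω i then (0 : ℝ) else 1) =
      (1 - p) ^ A.card := by
  have h := Finset.prod_univ_sum (fun _ : ι => (Finset.univ : Finset Bool))
    (fun i b => (if b then p else 1 - p) * (if i ∈ A then (if b then (0 : ℝ) else 1) else 1))
  rw [Fintype.piFinset_univ] at h
  simp_rw [Finset.prod_mul_distrib, Finset.prod_ite_mem, Finset.univ_inter] at h
  rw [← h, ← Finset.prod_const]
  rw [← Finset.univ_inter A, ← Finset.prod_ite_mem]
  refine Finset.prod_congr rfl fun i _ => ?_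
  by_cases hi : i ∈ A <;> simp [hi]

lemma count_true_take_lt {P : List Bool} {s t : ℕ} (hs : P[s]? = some true) (hst : s < t) :
    (P.take s).count true < (P.take t).count true := by
  calc (P.take s).count true < (P.take (s + 1)).count true := by
        rw [List.take_add_one, hs]; simp
    _ ≤ (P.take t).count true :=
        ((List.take_prefix_take_left (l := P) hst).sublist).count_le _

/-- Among the elements of `N` below `t`, at most one has no element of `N` strictly between
it and `t`. -/
lemma card_filter_lt_sub_one_le {α : Type*} [LinearOrder α] (N : Finset α) (t : α) :
    (N.filter (· < t)).card - 1 ≤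
      ((N.filter (· < t)).filter (fun i => ∃ j ∈ N, i < j ∧ j < t)).card := by
  have h : ((N.filter (· < t)).filter (fun i => ¬ ∃ j ∈ N, i < j ∧ j < t)).card ≤ 1 := by
    refine Finset.card_le_one.2 fun a ha b hb => ?_
    simp only [Finset.mem_filter] at ha hb
    rcases lt_trichotomy a b with h | h | h
    · exact absurd ⟨b, hb.1.1, h, hb.1.2⟩ ha.2
    · exact h
    · exact absurd ⟨a, ha.1.1, h, ha.1.2⟩ hb.2
  have := Finset.card_filter_add_card_filter_not (s := N.filter (· < t))
    (fun i => ∃ j ∈ N, i < j ∧ j < t)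
  omega

lemma card_filter_lt_injOn {α : Type*} [LinearOrder α] (N : Finset α) :
    Set.InjOn (fun t => (N.filter (· < t)).card) N := by
  have key : ∀ a ∈ N, ∀ b, a < b → (N.filter (· < a)).card < (N.filter (· < b)).card := by
    intro a ha b hab
    refine Finset.card_lt_card (Finset.ssubset_iff_of_subset ?_ |>.2 ⟨a, by simp [ha, hab], by simp⟩)
    exact Finset.monotone_filter_right _ fun x _ hx => lt_trans hx hab
  intro a ha b hb hab
  rcases lt_trichotomy a b with h | h | h
  · exact absurd hab (key a ha b h).ne
  · exact h
  · exact absurd hab.symm (key b hb a h).ne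

/-- Every directed non-adaptive policy — a root-to-leaf path `P` of `T`
together with a set `S` of (prefix-lengths of) nodes of `P` to attempt —
has expected collected reward at most `3·√L`.  Each node independently
instantiates to its size with probability `p = 1/√L` (outcome `ω`), and an
attempted node `w` at prefix-length `t` yields reward
`r_w = (1-p)^(τ(w))` iff `A_d(w)` plus the instantiated sizes of previously
attempted nodes plus the instantiated size of `w` itself is at most `B`. -/
theorem stmt9 (L : ℕ) (hL : 2 ≤ L) (p : ℝ) (hp : p = 1 / Real.sqrt L)
    (P : List Bool) (hP : P.length = L - 1) (S : Finset (Fin L)) :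
    ∑ ω : Fin L → Bool,
        (∏ i : Fin L, (if ω i then p else 1 - p)) *
          ∑ t ∈ S,
            (if Ad L (P.take t.val) +
                  (∑ t' ∈ S.filter (fun t' => t' < t),
                    (if ω t' then size L (P.take t'.val) else 0)) +
                  (if ω t then size L (P.take t.val) else 0) ≤ Bq L
              then (1 - p) ^ ((P.take t.val).count true) else 0) ≤
      3 * Real.sqrt L := by
  have hL0 : (1 : ℝ) ≤ Real.sqrt L := by
    rw [Real.one_le_sqrt]
    exact_mod_cast (by omega : 1 ≤ L)
  have hp0 : 0 < p := by rw [hp]; positivity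
  have hp1 : p ≤ 1 := by rw [hp, div_le_one (by linarith)]; exact hL0
  have hinv : 1 / p = Real.sqrt L := by rw [hp, one_div_one_div]
  have hq0 : 0 ≤ 1 - p := sub_nonneg.2 hp1
  have hμ : ∀ ω : Fin L → Bool, 0 ≤ ∏ i : Fin L, (if ω i then p else 1 - p) := fun ω =>
    Finset.prod_nonneg fun i _ => by split_ifs <;> linarith
  simp_rw [Finset.mul_sum]
  rw [Finset.sum_comm, ← Finset.sum_filter_add_sum_filter_not S (fun t => P[t.val]? = some true)]
  have hright : ∑ t ∈ S.filter (fun t => P[t.val]? = some true),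
      (1 - p) ^ ((P.take t.val).count true) ≤ 1 / p := by
    refine sum_pow_comp_le (g := fun t : Fin L => (P.take t.val).count true) ?_ hp0 hp1
    intro a ha b hb hab
    simp only [Finset.coe_filter, Set.mem_ofPred_eq] at ha hb
    rcases lt_trichotomy a b with h | h | h
    · exact absurd hab (count_true_take_lt ha.2 h).ne
    · exact h
    · exact absurd hab (count_true_take_lt hb.2 h).ne'
  set N := S.filter (fun t => ¬ P[t.val]? = some true)
  have hfalse : ∀ i ∈ N, ∀ t : Fin L, i < t → P[i.val]? = some false := by
    intro i hi t hit
    have hlen : i.val < P.length := by have := t.isLt; have : i.val < t.val := hit; omega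
    have hne := (Finset.mem_filter.1 hi).2
    rw [List.getElem?_eq_getElem hlen] at hne ⊢
    simpa using hne
  have hleft := sum_pow_comp_pred_le (card_filter_lt_injOn N) hp0 hp1
  refine (add_le_add ((Finset.sum_le_sum fun t _ => ?_).trans hright)
    ((Finset.sum_le_sum fun t ht => ?_).trans hleft)).trans (by rw [hinv]; linarith)
  · calc _ ≤ ∑ ω : Fin L → Bool, (∏ i : Fin L, (if ω i then p else 1 - p)) *
          (1 - p) ^ ((P.take t.val).count true) := by
          refine Finset.sum_le_sum fun ω _ => mul_le_mul_of_nonneg_left ?_ (hμ ω)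
          split_ifs <;> first | exact le_rfl | positivity
      _ = _ := by
          have := sum_bernoulli_mul_prod p (∅ : Finset (Fin L))
          simp only [Finset.prod_empty, mul_one, Finset.card_empty, pow_zero] at this
          rw [← Finset.sum_mul, this, one_mul]
  · set A := (N.filter (· < t)).filter (fun i => ∃ j ∈ N, i < j ∧ j < t) with hA
    calc _ ≤ ∑ ω : Fin L → Bool, (∏ i : Fin L, (if ω i then p else 1 - p)) *
          ∏ i ∈ A, (if ω i then (0 : ℝ) else 1) := by
          refine Finset.sum_le_sum fun ω _ => mul_le_mul_of_nonneg_left ?_ (hμ ω)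
          by_cases hω : ∃ i ∈ A, ω i = true
          · obtain ⟨i, hi, hωi⟩ := hω
            rw [if_neg, Finset.prod_eq_zero hi (by simp [hωi])]
            simp only [hA, Finset.mem_filter] at hi
            obtain ⟨⟨hiN, hit⟩, j, hjN, hij, hjt⟩ := hi
            have hB := lt_Ad_add_size L P i j t (hfalse i hiN t hit) hij (hfalse j hjN t hjt) hjt
              (by have := t.isLt; omega) (by omega)
            have hsum := Finset.single_le_sum
              (f := fun t' : Fin L => if ω t' then size L (P.take t'.val) else 0)
              (s := S.filter (fun t' => t' < t))
              (fun k _ => by split_ifs; exacts [size_nonneg L P k, le_rfl])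
              (Finset.mem_filter.2 ⟨(Finset.mem_filter.1 hiN).1, hit⟩)
            simp only [hωi, if_true] at hsum
            have hlast : 0 ≤ if ω t then size L (P.take t.val) else 0 := by
              split_ifs
              exacts [size_nonneg L P t, le_rfl]
            linarith
          · push Not at hω
            rw [Finset.prod_eq_one fun i hi => by simp [hω i hi]]
            split_ifs <;> first | exact zero_le_one | exact pow_le_one₀ hq0 (by linarith)
      _ = (1 - p) ^ A.card := sum_bernoulli_mul_prod p A
      _ ≤ _ := pow_le_pow_of_le_one hq0 (by linarith)
          ((card_filter_lt_sub_one_le N t).trans_eq (by rw [hA]; congr!))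
end

section
/- Let B, X ≥ 0 be reals, p ∈ [0,1], let 0 ≤ s_u ≤ s_v be reals, and let r_u ≥ r_v ≥ 0 be reals. Let S_u and S_v be independent random variables with S_u = s_u with probability p and S_u = 0 with probability 1−p, and S_v = s_v with probability p and S_v = 0 with probability 1−p. Then E[ r_u·1{X + S_u ≤ B} + r_v·1{X + S_u + S_v ≤ B} ] ≥ E[ r_v·1{X + S_v ≤ B} + r_u·1{X + S_v + S_u ≤ B} ]. (Interpretation: attempting the job with smaller size and larger reward first yields at least as much expected reward as the opposite order.) -/
/-- Exchange argument: two independent jobs, each instantiating to its positive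
size with probability `p` and to `0` otherwise, are attempted consecutively
after an already-used budget `X` out of budget `B`; a job's reward is collected
iff the cumulative used budget including its own size is at most `B`.
Attempting the job with smaller size `s_u` and larger reward `r_u` first yields
at least as much expected reward as the opposite order. -/
theorem stmt15 (B X p su sv ru rv : ℝ) (hB : 0 ≤ B) (hX : 0 ≤ X)
    (hp0 : 0 ≤ p) (hp1 : p ≤ 1) (hsu : 0 ≤ su) (hsuv : su ≤ sv)
    (hrv : 0 ≤ rv) (hruv : rv ≤ ru) :
    ∑ ω : Bool × Bool,
        ((if ω.1 then p else 1 - p) * (if ω.2 then p else 1 - p)) *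
          ((if X + (if ω.1 then su else 0) ≤ B then ru else 0) +
            (if X + (if ω.1 then su else 0) + (if ω.2 then sv else 0) ≤ B then rv else 0)) ≥
      ∑ ω : Bool × Bool,
        ((if ω.1 then p else 1 - p) * (if ω.2 then p else 1 - p)) *
          ((if X + (if ω.2 then sv else 0) ≤ B then rv else 0) +
            (if X + (if ω.2 then sv else 0) + (if ω.1 then su else 0) ≤ B then ru else 0)) := by
  have hq : 0 ≤ p * (1 - p) := mul_nonneg hp0 (sub_nonneg.2 hp1)
  have h₁ := mul_nonneg hq (sub_nonneg.2 hruv)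
  have h₂ := mul_nonneg hq hrv
  have h₃ := mul_nonneg (mul_nonneg hp0 hp0) (sub_nonneg.2 hruv)
  have h₄ := mul_nonneg (mul_nonneg hp0 hp0) hrv
  simp only [Fintype.sum_prod_type, Fintype.sum_bool, if_true, Bool.false_eq_true, if_false,
    add_zero, add_right_comm X sv su]
  split_ifs <;> first | (exfalso; linarith) | nlinarith
end
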